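/- Let k be a field, C a category, H, H' : C ⥤ ModuleCat k functors, and θ : H ⟶ H' a natural transformation. Then for any ℝ-diagrams F, G in C, d_I(img_θ(F), img_θ(G)) ≤ d_I(F, G) and d_I(ker_θ(F), ker_θ(G)) ≤ d_I(F, G), where d_I denotes the interleaving distance. -/

import Mathlib

open CategoryTheory

variable {k : Type*} [Field k]

/-- The image of a natural transformation of persistence modules: pointwise the range,
with structure maps the restrictions of those of the target (well defined by naturality). -/
noncomputable def imgFunctor {M N : ℝ ⥤ ModuleCat k} (f : M ⟶ N) : ℝ ⥤ ModuleCat k where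
  obj r := ModuleCat.of k (LinearMap.range (f.app r).hom)
  map {s t} h := ModuleCat.ofHom <| (N.map h).hom.restrict (p := LinearMap.range (f.app s).hom)
    (q := LinearMap.range (f.app t).hom) (fun x hx => by
      obtain ⟨y, rfl⟩ := hx
      refine ⟨M.map h y, ?_⟩
      have : (M.map h ≫ f.app t) y = (f.app s ≫ N.map h) y := by rw [f.naturality h]
      exact this)
  map_id r := by
    ext x
    show N.map (𝟙 r) x.val = x.val
    simp
  map_comp {s t u} h h' := by
    ext x
    show N.map (h ≫ h') x.val = N.map h' (N.map h x.val)
    simp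

/-- The kernel of a natural transformation of persistence modules: pointwise the kernel,
with structure maps the restrictions of those of the source (well defined by naturality). -/
noncomputable def kerFunctor {M N : ℝ ⥤ ModuleCat k} (f : M ⟶ N) : ℝ ⥤ ModuleCat k where
  obj r := ModuleCat.of k (LinearMap.ker (f.app r).hom)
  map {s t} h := ModuleCat.ofHom <| (M.map h).hom.restrict (p := LinearMap.ker (f.app s).hom)
    (q := LinearMap.ker (f.app t).hom) (fun x hx => by
      simp only [LinearMap.mem_ker] at hx ⊢
      have : (M.map h ≫ f.app t) x = (f.app s ≫ N.map h) x := by rw [f.naturality h]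
      show (M.map h ≫ f.app t) x = 0
      rw [this]
      show N.map h (f.app s x) = 0
      rw [hx]
      simp)
  map_id r := by
    ext x
    show M.map (𝟙 r) x.val = x.val
    simp
  map_comp {s t u} h h' := by
    ext x
    show M.map (h ≫ h') x.val = M.map h' (M.map h x.val)
    simp

/-- Given a natural transformation `θ : H ⟶ H'` (a linear cohomology operation) and an
`ℝ`-diagram `F` in `C`, the induced natural transformation `θF : F ⋙ H ⟶ F ⋙ H'`
of persistence modules. -/
def thetaF {C : Type*} [Category C] {H H' : C ⥤ ModuleCat k} (θ : H ⟶ H')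
    (F : ℝ ⥤ C) : (F ⋙ H) ⟶ (F ⋙ H') :=
  Functor.whiskerLeft F θ

/-- `img_θ(F)`, the image persistence module of the operation `θ` on the diagram `F`. -/
noncomputable def imgTheta {C : Type*} [Category C] {H H' : C ⥤ ModuleCat k} (θ : H ⟶ H')
    (F : ℝ ⥤ C) : ℝ ⥤ ModuleCat k :=
  imgFunctor (thetaF θ F)

/-- `ker_θ(F)`, the kernel persistence module of the operation `θ` on the diagram `F`. -/
noncomputable def kerTheta {C : Type*} [Category C] {H H' : C ⥤ ModuleCat k} (θ : H ⟶ H')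
    (F : ℝ ⥤ C) : ℝ ⥤ ModuleCat k :=
  kerFunctor (thetaF θ F)

/-- Two `ℝ`-diagrams `F G : ℝ ⥤ C` are `δ`-interleaved (for `δ ≥ 0`) if there are
families of morphisms `φ_r : F r ⟶ G (r + δ)` and `ψ_r : G r ⟶ F (r + δ)`, natural in `r`,
whose composites recover the structure maps `F (r ≤ r + 2δ)` and `G (r ≤ r + 2δ)`. -/
def Interleaved {C : Type*} [Category C] (δ : ℝ) (hδ : 0 ≤ δ) (F G : ℝ ⥤ C) : Prop :=
  ∃ (φ : ∀ r : ℝ, F.obj r ⟶ G.obj (r + δ)) (ψ : ∀ r : ℝ, G.obj r ⟶ F.obj (r + δ)),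
    (∀ (s t : ℝ) (h : s ≤ t),
        F.map (homOfLE h) ≫ φ t = φ s ≫ G.map (homOfLE (add_le_add_left h δ))) ∧
    (∀ (s t : ℝ) (h : s ≤ t),
        G.map (homOfLE h) ≫ ψ t = ψ s ≫ F.map (homOfLE (add_le_add_left h δ))) ∧
    (∀ r : ℝ, φ r ≫ ψ (r + δ) =
        F.map (homOfLE (by linarith : r ≤ r + δ + δ))) ∧
    (∀ r : ℝ, ψ r ≫ φ (r + δ) =
        G.map (homOfLE (by linarith : r ≤ r + δ + δ)))

open scoped ENNReal

/-- The interleaving distance between two `ℝ`-diagrams, valued in `ℝ≥0∞`: the infimum of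
the set of `δ ≥ 0` such that the diagrams are `δ`-interleaved. -/
noncomputable def interleavingDist {C : Type*} [Category C] (F G : ℝ ⥤ C) : ℝ≥0∞ :=
  sInf {e : ℝ≥0∞ | ∃ (δ : ℝ) (hδ : 0 ≤ δ), e = ENNReal.ofReal δ ∧ Interleaved δ hδ F G}

/-- The functor sending `X` to the range of `θ.app X`. -/
noncomputable def rangeFunctor {C : Type*} [Category C] {H H' : C ⥤ ModuleCat k}
    (θ : H ⟶ H') : C ⥤ ModuleCat k where
  obj X := ModuleCat.of k (LinearMap.range (θ.app X).hom)
  map {X Y} h := ModuleCat.ofHom <| (H'.map h).hom.restrict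
    (p := LinearMap.range (θ.app X).hom) (q := LinearMap.range (θ.app Y).hom) (by
      rintro _ ⟨y, rfl⟩
      exact ⟨H.map h y, ConcreteCategory.congr_hom (θ.naturality h) y⟩)
  map_id X := by
    ext x
    change H'.map (𝟙 X) x.val = x.val
    simp
  map_comp h h' := by
    ext x
    change H'.map (h ≫ h') x.val = H'.map h' (H'.map h x.val)
    simp

/-- The functor sending `X` to the kernel of `θ.app X`. -/
noncomputable def kernelFunctor {C : Type*} [Category C] {H H' : C ⥤ ModuleCat k}
    (θ : H ⟶ H') : C ⥤ ModuleCat k where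
  obj X := ModuleCat.of k (LinearMap.ker (θ.app X).hom)
  map {X Y} h := ModuleCat.ofHom <| (H.map h).hom.restrict
    (p := LinearMap.ker (θ.app X).hom) (q := LinearMap.ker (θ.app Y).hom) (fun x hx => by
      have hnat : θ.app Y (H.map h x) = H'.map h (θ.app X x) :=
        ConcreteCategory.congr_hom (θ.naturality h) x
      have hzero : θ.app X x = 0 := hx
      rw [hzero, map_zero] at hnat
      exact hnat)
  map_id X := by
    ext x
    change H.map (𝟙 X) x.val = x.val
    simp
  map_comp h h' := by
    ext x
    change H.map (h ≫ h') x.val = H.map h' (H.map h x.val)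
    simp

theorem imgTheta_eq_comp_rangeFunctor {C : Type*} [Category C] {H H' : C ⥤ ModuleCat k}
    (θ : H ⟶ H') (F : ℝ ⥤ C) : imgTheta θ F = F ⋙ rangeFunctor θ :=
  rfl

theorem kerTheta_eq_comp_kernelFunctor {C : Type*} [Category C] {H H' : C ⥤ ModuleCat k}
    (θ : H ⟶ H') (F : ℝ ⥤ C) : kerTheta θ F = F ⋙ kernelFunctor θ :=
  rfl

/-- Postcomposition with a functor preserves interleavings. -/
theorem Interleaved.comp {C D : Type*} [Category C] [Category D] {δ : ℝ} {hδ : 0 ≤ δ}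
    {F G : ℝ ⥤ C} (h : Interleaved δ hδ F G) (K : C ⥤ D) :
    Interleaved δ hδ (F ⋙ K) (G ⋙ K) := by
  obtain ⟨φ, ψ, hφ, hψ, hφψ, hψφ⟩ := h
  refine ⟨fun r => K.map (φ r), fun r => K.map (ψ r), fun s t hst => ?_, fun s t hst => ?_,
    fun r => ?_, fun r => ?_⟩
  · simp only [Functor.comp_map, ← K.map_comp, hφ s t hst]
  · simp only [Functor.comp_map, ← K.map_comp, hψ s t hst]
  · simp only [Functor.comp_map, ← K.map_comp, hφψ r]
  · simp only [Functor.comp_map, ← K.map_comp, hψφ r]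

/-- Postcomposition with a functor does not increase the interleaving distance. -/
theorem interleavingDist_comp_le {C D : Type*} [Category C] [Category D] (F G : ℝ ⥤ C)
    (K : C ⥤ D) : interleavingDist (F ⋙ K) (G ⋙ K) ≤ interleavingDist F G :=
  sInf_le_sInf fun _ ⟨δ, hδ, he, h⟩ => ⟨δ, hδ, he, h.comp K⟩

/-- The interleaving distances of the image and kernel persistence modules of a linear
cohomology operation are bounded by the interleaving distance of the diagrams. -/
theorem interleavingDist_imgTheta_kerTheta_le {C : Type*} [Category C]
    {H H' : C ⥤ ModuleCat k} (θ : H ⟶ H') (F G : ℝ ⥤ C) :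
    interleavingDist (imgTheta θ F) (imgTheta θ G) ≤ interleavingDist F G ∧
    interleavingDist (kerTheta θ F) (kerTheta θ G) ≤ interleavingDist F G := by
  rw [imgTheta_eq_comp_rangeFunctor, imgTheta_eq_comp_rangeFunctor,
    kerTheta_eq_comp_kernelFunctor, kerTheta_eq_comp_kernelFunctor]
  exact ⟨interleavingDist_comp_le F G _, interleavingDist_comp_le F G _⟩
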